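/- For all n > 1 and 1 < k ≤ C(n−1, ⌊(n−1)/2⌋): (a) every nondeterministic Streett word automaton (NSW) accepting the complement Σ_n^ω \ L(FB_{n,k}) has at least (n−1)! · ⌊k/2⌋^{n−1} states; (b) every deterministic complete Rabin word automaton (DRW) accepting L(FB_{n,k}) has at least (n−1)! · ⌊k/2⌋^{n−1} states. -/

import Mathlib

namespace YanPaper

/-- A finite run, represented as the list of visited states, over a finite word. -/
def RunOn {S A : Type*} (Δ : S → A → S → Prop) : List S → List A → Prop
  | [_], [] => True
  | p :: q :: ρ, a :: w => Δ p a q ∧ RunOn Δ (q :: ρ) w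
  | _, _ => False

/-- `p` reaches `q` via some finite run over the word `w`. -/
def Reaches {S A : Type*} (Δ : S → A → S → Prop) (p : S) (w : List A) (q : S) : Prop :=
  ∃ ρ : List S, RunOn Δ ρ w ∧ ρ.head? = some p ∧ ρ.getLast? = some q

/-- `p` reaches `q` via some finite run over `w` that visits the set `T`. -/
def ReachesVisit {S A : Type*} (Δ : S → A → S → Prop) (T : Set S) (p : S) (w : List A)
    (q : S) : Prop :=
  ∃ ρ : List S, RunOn Δ ρ w ∧ ρ.head? = some p ∧ ρ.getLast? = some q ∧ ∃ s ∈ ρ, s ∈ T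

/-- Nondeterministic finite word automaton. -/
structure NFW (A : Type*) (S : Type*) where
  I : Set S
  Δ : S → A → S → Prop
  F : Set S

def NFW.Lang {A S : Type*} (M : NFW A S) : Set (List A) :=
  {w | ∃ p ∈ M.I, ∃ q ∈ M.F, Reaches M.Δ p w q}

/-- The full NFW over state set `S`: the alphabet is the set of all binary relations on `S`. -/
def FullNFW (S : Type*) (I F : Set S) : NFW (Set (S × S)) S where
  I := I
  Δ := fun p a q => (p, q) ∈ a
  F := F

/-- Minimal number of states of an NFW over alphabet `A` accepting the language `L`. -/
noncomputable def NFWminStates (A : Type*) (L : Set (List A)) : ℕ :=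
  sInf {c : ℕ | ∃ C : NFW A (Fin c), C.Lang = L}

/-- A two letter alphabet. -/
inductive AB : Type
  | a : AB
  | b : AB

/-- States occurring infinitely often in an infinite run. -/
def InfOcc {S : Type*} (ρ : ℕ → S) : Set S := {s | ∀ n : ℕ, ∃ m, n ≤ m ∧ ρ m = s}

/-- Nondeterministic Büchi word automaton. -/
structure NBW (A : Type*) (S : Type*) where
  I : Set S
  Δ : S → A → S → Prop
  F : Set S

def NBW.Lang {A S : Type*} (M : NBW A S) : Set (ℕ → A) :=
  {α | ∃ ρ : ℕ → S, ρ 0 ∈ M.I ∧ (∀ i, M.Δ (ρ i) (α i) (ρ (i + 1))) ∧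
        (InfOcc ρ ∩ M.F).Nonempty}

/-- The full NBW over state set `S`. -/
def FullNBW (S : Type*) (I F : Set S) : NBW (Set (S × S)) S where
  I := I
  Δ := fun p a q => (p, q) ∈ a
  F := F

/-- Minimal number of states of an NBW over alphabet `A` accepting the ω-language `L`. -/
noncomputable def NBWminStates (A : Type*) (L : Set (ℕ → A)) : ℕ :=
  sInf {c : ℕ | ∃ C : NBW A (Fin c), C.Lang = L}

/-- Vertex `(q, l)` of the Δ-graph of `α` is reachable from an initial vertex `(q_I, 0)`. -/
def GraphReach {A S : Type*} (M : NBW A S) (α : ℕ → A) (q : S) (l : ℕ) : Prop :=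
  ∃ ρ : ℕ → S, ρ 0 ∈ M.I ∧ (∀ i, i < l → M.Δ (ρ i) (α i) (ρ (i + 1))) ∧ ρ l = q

/-- A co-Büchi ranking for the Δ-graph of `α` under `M`, as a partial function
`S × ℕ → {0, …, 2n-2}` represented with `Option ℕ`. -/
def CRanking {A S : Type*} [Fintype S] (M : NBW A S) (α : ℕ → A)
    (f : S → ℕ → Option ℕ) : Prop :=
  (∀ q l r, f q l = some r → r ≤ 2 * Fintype.card S - 2) ∧
  (∀ q l, (f q l).isSome ↔ GraphReach M α q l) ∧
  (∀ q l r, f q l = some r → Odd r → q ∉ M.F) ∧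
  (∀ q l q', M.Δ q (α l) q' → ∀ r r', f q l = some r → f q' (l + 1) = some r' → r' ≤ r)

/-- The C-ranking `f` is odd: every infinite path of the Δ-graph starting at an initial
vertex has infinitely many odd-ranked vertices. -/
def OddCRanking {A S : Type*} [Fintype S] (M : NBW A S) (α : ℕ → A)
    (f : S → ℕ → Option ℕ) : Prop :=
  ∀ ρ : ℕ → S, ρ 0 ∈ M.I → (∀ i, M.Δ (ρ i) (α i) (ρ (i + 1))) →
    ∀ N : ℕ, ∃ l, N ≤ l ∧ ∃ r, f (ρ l) l = some r ∧ Odd r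

/-- The state space of the full NBW `FB n`: `none` is the final state `s_f`, and
`some i` is the main state `s_i`. -/
abbrev FBState (n : ℕ) := Option (Fin (n - 1))

/-- The alphabet of a full automaton with state space `FBState n`. -/
abbrev FBAlpha (n : ℕ) := Set (FBState n × FBState n)

/-- The full NBW `FB n`, with `n` states, main states initial and `s_f = none` final. -/
def FB (n : ℕ) : NBW (FBAlpha n) (FBState n) where
  I := {s | s ≠ none}
  Δ := fun p a q => (p, q) ∈ a
  F := {none}

/-- A `Q(m)`-ranking for `FB n`: a function on the main states with values in
`{0, …, 2m-1}` whose range contains all odd numbers in `{0, …, 2m-1}`. -/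
def QRanking (n m : ℕ) (g : Fin (n - 1) → ℕ) : Prop :=
  (∀ q, g q < 2 * m) ∧ ∀ r, r < 2 * m → Odd r → ∃ q, g q = r

/-- `w` is an `(f, g)`-segment for `FB n` (properties (P1), (P2), (P3)). -/
def IsSeg (n : ℕ) (f g : Fin (n - 1) → ℕ) (w : List (FBAlpha n)) : Prop :=
  w ≠ [] ∧
  (∀ p q : Fin (n - 1),
    Reaches (FB n).Δ (some p) w (some q) ↔ (g q < f p ∨ (f p = g q ∧ Odd (f p)))) ∧
  (∀ p q : Fin (n - 1),
    ReachesVisit (FB n).Δ {none} (some p) w (some q) ↔ g q < f p) ∧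
  (∀ p q : FBState n, Reaches (FB n).Δ p w q → p ≠ none ∧ q ≠ none)

/-- `L(n, m)`: the number of `Q(m)`-rankings for `FB n`. -/
noncomputable def Lnm (n m : ℕ) : ℕ := Nat.card {g : Fin (n - 1) → ℕ // QRanking n m g}

/-- `L(n) = max_{1 ≤ m < n} L(n, m)`. -/
noncomputable def Lmax (n : ℕ) : ℕ := (Finset.Ico 1 n).sup (fun m => Lnm n m)

/-- Nondeterministic Muller word automaton. -/
structure NMW (A : Type*) (S : Type*) where
  I : Set S
  Δ : S → A → S → Prop
  Acc : Set (Set S)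

def NMW.Lang {A S : Type*} (M : NMW A S) : Set (ℕ → A) :=
  {α | ∃ ρ : ℕ → S, ρ 0 ∈ M.I ∧ (∀ i, M.Δ (ρ i) (α i) (ρ (i + 1))) ∧ InfOcc ρ ∈ M.Acc}

/-- Nondeterministic generalized Büchi word automaton of index `k`. -/
structure NGBW (A : Type*) (S : Type*) where
  I : Set S
  Δ : S → A → S → Prop
  k : ℕ
  F : Fin k → Set S

def NGBW.Lang {A S : Type*} (M : NGBW A S) : Set (ℕ → A) :=
  {α | ∃ ρ : ℕ → S, ρ 0 ∈ M.I ∧ (∀ i, M.Δ (ρ i) (α i) (ρ (i + 1))) ∧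
        ∀ i, (InfOcc ρ ∩ M.F i).Nonempty}

/-- Nondeterministic Streett word automaton of index `k`. -/
structure NSW (A : Type*) (S : Type*) where
  I : Set S
  Δ : S → A → S → Prop
  k : ℕ
  acc : Fin k → Set S × Set S

def NSW.Lang {A S : Type*} (M : NSW A S) : Set (ℕ → A) :=
  {α | ∃ ρ : ℕ → S, ρ 0 ∈ M.I ∧ (∀ i, M.Δ (ρ i) (α i) (ρ (i + 1))) ∧
        ∀ i, (InfOcc ρ ∩ (M.acc i).2).Nonempty → (InfOcc ρ ∩ (M.acc i).1).Nonempty}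

/-- Nondeterministic Rabin word automaton of index `k`. -/
structure NRW (A : Type*) (S : Type*) where
  I : Set S
  Δ : S → A → S → Prop
  k : ℕ
  acc : Fin k → Set S × Set S

def NRW.Lang {A S : Type*} (M : NRW A S) : Set (ℕ → A) :=
  {α | ∃ ρ : ℕ → S, ρ 0 ∈ M.I ∧ (∀ i, M.Δ (ρ i) (α i) (ρ (i + 1))) ∧
        ∃ i, (InfOcc ρ ∩ (M.acc i).1).Nonempty ∧ InfOcc ρ ∩ (M.acc i).2 = ∅}

/-- The `k`-fold concatenation `w^k` of a finite word. -/
def listPow {A : Type*} (w : List A) (k : ℕ) : List A := (List.replicate k w).flatten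

/-- `α` is the ω-word `u · v^ω`. -/
def IsUVOmega {A : Type*} (u v : List A) (α : ℕ → A) : Prop :=
  (∀ i (h : i < u.length), α i = u.get ⟨i, h⟩) ∧
  (∀ i j (h : j < v.length), α (u.length + i * v.length + j) = v.get ⟨j, h⟩)

/-- A GC-segment of the NGBW `B`: a nonempty finite word `w` with `w^ω ∉ L(B)`. -/
def GCSeg {A S : Type*} (B : NGBW A S) (w : List A) : Prop :=
  w ≠ [] ∧ ∀ α, IsUVOmega [] w α → α ∉ B.Lang

/-- Two GC-segments conflict: every ω-word `w₁^{k₀} (w₁^{k₁} w₂^{k₂})^ω` is in `L(B)`. -/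
def Conflict {A S : Type*} (B : NGBW A S) (w₁ w₂ : List A) : Prop :=
  ∀ k₀ k₁ k₂ : ℕ, 0 < k₀ → 0 < k₁ → 0 < k₂ →
    ∀ α, IsUVOmega (listPow w₁ k₀) (listPow w₁ k₁ ++ listPow w₂ k₂) α → α ∈ B.Lang

/-- The full NGBW `FB (n,k)` with all states initial, distinguished state `s_nf = none`,
and acceptance sets `F i` (subsets of the main states). -/
def FBgen (n k : ℕ) (F : Fin k → Finset (Fin (n - 1))) :
    NGBW (FBAlpha n) (FBState n) where
  I := Set.univ
  Δ := fun p a q => (p, q) ∈ a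
  k := k
  F := fun i => {s | ∃ q ∈ F i, s = some q}

/-- The conditions on the acceptance condition of `FB (n,k)`: the sets are pairwise
distinct, each of size `⌊(n-1)/2⌋`, and each main state avoids at least `⌊k/2⌋` sets. -/
def GoodAcc (n k : ℕ) (F : Fin k → Finset (Fin (n - 1))) : Prop :=
  Function.Injective F ∧ (∀ i, (F i).card = (n - 1) / 2) ∧
  ∀ q : Fin (n - 1), k / 2 ≤ {i : Fin k | q ∉ F i}.ncard

/-- A PGCL-ranking for `FB (n,k)`: `f` is a bijection from the main states onto
`{1, …, n-1}` and `g` chooses for each main state `q` an index with `q ∉ F (g q)`. -/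
def PGCL (n k : ℕ) (F : Fin k → Finset (Fin (n - 1)))
    (f : Fin (n - 1) → ℕ) (g : Fin (n - 1) → Fin k) : Prop :=
  (∀ p, 1 ≤ f p ∧ f p ≤ n - 1) ∧ Function.Injective f ∧
  (∀ r, 1 ≤ r → r ≤ n - 1 → ∃ p, f p = r) ∧
  ∀ q, q ∉ F (g q)

/-- `ρ` is a finite run over `w` from `p` to `q`. -/
def RunFromTo {S A : Type*} (Δ : S → A → S → Prop) (w : List A) (p q : S)
    (ρ : List S) : Prop :=
  RunOn Δ ρ w ∧ ρ.head? = some p ∧ ρ.getLast? = some q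

/-- `w` is an `⟨f, g⟩`-segment for `FB (n,k)` (properties (Q0)–(Q3)). -/
def IsSegGen (n k : ℕ) (F : Fin k → Finset (Fin (n - 1)))
    (f : Fin (n - 1) → ℕ) (g : Fin (n - 1) → Fin k)
    (w : List (FBAlpha n)) : Prop :=
  w ≠ [] ∧
  -- (Q0) every finite run over `w` ends in a main state
  (∀ (ρ : List (FBState n)) (x : FBState n),
    RunOn (FBgen n k F).Δ ρ w → ρ.getLast? = some x → x ≠ none) ∧
  -- (Q1)
  (∀ p : Fin (n - 1),
    (∃! ρ, RunFromTo (FBgen n k F).Δ w (some p) (some p) ρ) ∧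
    ∀ ρ, RunFromTo (FBgen n k F).Δ w (some p) (some p) ρ →
      (∀ i, i ≠ g p → ∃ s ∈ ρ, ∃ q ∈ F i, s = some q) ∧
      (∀ s ∈ ρ, ∀ q ∈ F (g p), s ≠ some q)) ∧
  -- (Q2)
  (∀ p q : Fin (n - 1), f q < f p →
    (∃! ρ, RunFromTo (FBgen n k F).Δ w (some p) (some q) ρ) ∧
    ∀ ρ, RunFromTo (FBgen n k F).Δ w (some p) (some q) ρ →
      ∀ i, ∃ s ∈ ρ, ∃ r ∈ F i, s = some r) ∧
  -- (Q3)
  (∀ p q : Fin (n - 1), f p < f q →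
    ¬∃ ρ, RunFromTo (FBgen n k F).Δ w (some p) (some q) ρ)

section Helpers

/-- Finite path with exact set of visited states (excluding the last one). -/
def HPath {S A : Type*} (Δ : S → A → S → Prop) : S → List A → S → Set S → Prop
  | p, [], q, X => p = q ∧ X = ∅
  | p, a :: w, q, X => ∃ r Y, Δ p a r ∧ HPath Δ r w q Y ∧ X = insert p Y

theorem HPath_append {S A : Type*} {Δ : S → A → S → Prop} (u v : List A) (p q : S) (X : Set S) :
    HPath Δ p (u ++ v) q X ↔ ∃ r Y Z, HPath Δ p u r Y ∧ HPath Δ r v q Z ∧ X = Y ∪ Z := by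
  induction u generalizing p X with
  | nil =>
    constructor
    · intro h
      exact ⟨p, ∅, X, ⟨rfl, rfl⟩, h, by simp⟩
    · rintro ⟨r, Y, Z, ⟨rfl, rfl⟩, h, rfl⟩
      simpa using h
  | cons a u ih =>
    constructor
    · rintro ⟨r, Y, h1, h2, rfl⟩
      obtain ⟨r', Y', Z', h3, h4, rfl⟩ := (ih _ _).1 h2
      exact ⟨r', insert p Y', Z', ⟨r, Y', h1, h3, rfl⟩, h4, by rw [Set.insert_union]⟩
    · rintro ⟨r, Y, Z, ⟨r', Y', h1, h2, rfl⟩, h3, rfl⟩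
      exact ⟨r', Y' ∪ Z, h1, (ih _ _).2 ⟨r, Y', Z, h2, h3, rfl⟩, by rw [Set.insert_union]⟩

theorem HPath.append {S A : Type*} {Δ : S → A → S → Prop} {u v : List A} {p q r : S} {X Y : Set S}
    (h1 : HPath Δ p u q X) (h2 : HPath Δ q v r Y) : HPath Δ p (u ++ v) r (X ∪ Y) :=
  (HPath_append _ _ _ _ _).2 ⟨_, _, _, h1, h2, rfl⟩

theorem HPath.pow_loop {S A : Type*} {Δ : S → A → S → Prop} {u : List A} {p : S} {X : Set S}
    (h1 : HPath Δ p u p X) (k : ℕ) : ∃ Y, HPath Δ p (listPow u k) p Y := by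
  induction k with
  | zero => exact ⟨∅, rfl, rfl⟩
  | succ k ih =>
    obtain ⟨Y, hY⟩ := ih
    refine ⟨X ∪ Y, ?_⟩
    have : listPow u (k + 1) = u ++ listPow u k := by
      simp [listPow, List.replicate_succ]
    rw [this]
    exact h1.append hY

theorem HPath.pow_end {S A : Type*} {Δ : S → A → S → Prop} {u : List A} {p q : S} {X Y : Set S}
    (h1 : HPath Δ p u p X) (h2 : HPath Δ p u q Y) (k : ℕ) (hk : 0 < k) :
    ∃ Z, HPath Δ p (listPow u k) q Z ∧ Y ⊆ Z := by
  obtain ⟨k, rfl⟩ : ∃ j, k = j + 1 := ⟨k - 1, by omega⟩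
  obtain ⟨Z, hZ⟩ := h1.pow_loop k
  refine ⟨Z ∪ Y, ?_, Set.subset_union_right⟩
  have : listPow u (k + 1) = listPow u k ++ u := by
    simp [listPow, List.replicate_succ']
  rw [this]
  exact hZ.append h2

/-- The periodic word. -/
def hom {A : Type*} [Inhabited A] (w : List A) : ℕ → A := fun i => w.getD (i % w.length) default

/-- Prefixing of an infinite word. -/
def happ {A : Type*} : List A → (ℕ → A) → ℕ → A
  | [], α => α
  | a :: u, α => fun i => Nat.casesOn i a (fun j => happ u α j)

theorem HPath_of_run {S A : Type*} {Δ : S → A → S → Prop} (α : ℕ → A) (ρ : ℕ → S)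
    (h : ∀ i, Δ (ρ i) (α i) (ρ (i + 1))) (m i : ℕ) :
    HPath Δ (ρ i) ((List.range' i m).map α) (ρ (i + m)) (ρ '' Set.Ico i (i + m)) := by
  induction m generalizing i with
  | zero => exact ⟨rfl, by simp⟩
  | succ m ih =>
    rw [List.range'_succ, List.map_cons]
    have := ih (i + 1)
    refine ⟨_, ρ '' Set.Ico (i + 1) (i + 1 + m), h i, ?_, ?_⟩
    · rw [show i + (m + 1) = i + 1 + m by omega]
      exact this
    · rw [← Set.image_insert_eq]
      congr 1
      ext x
      simp only [Set.mem_Ico, Set.mem_insert_iff]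
      omega

theorem hom_block {A : Type*} [Inhabited A] (w : List A) (i : ℕ) :
    (List.range' (i * w.length) w.length).map (hom w) = w := by
  apply List.ext_getElem
  · simp
  · intro j h1 h2
    simp [hom, Nat.mod_eq_of_lt h2, List.getElem?_eq_getElem h2]

theorem hom_blocks {A : Type*} [Inhabited A] (w : List A) (i k : ℕ) :
    (List.range' (i * w.length) (k * w.length)).map (hom w) = listPow w k := by
  induction k generalizing i with
  | zero => simp [listPow]
  | succ k ih =>
    have h1 : listPow w (k + 1) = w ++ listPow w k := by
      simp [listPow, List.replicate_succ]
    have h2 : (k + 1) * w.length = w.length + k * w.length := by ring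
    have h3 := ih (i + 1)
    rw [Nat.succ_mul] at h3
    rw [h1, h2, ← List.range'_append_1, List.map_append, hom_block, h3]

theorem HPath.to_fun {S A : Type*} [Inhabited A] {Δ : S → A → S → Prop} {w : List A} {p q : S}
    {X : Set S} (h : HPath Δ p w q X) :
    ∃ σ : ℕ → S, σ 0 = p ∧ σ w.length = q ∧
      (∀ i, i < w.length → Δ (σ i) (w.getD i default) (σ (i + 1))) ∧
      X = σ '' Set.Iio w.length := by
  induction w generalizing p X with
  | nil =>
    obtain ⟨rfl, rfl⟩ := h
    exact ⟨fun _ => p, rfl, rfl, by simp, by simp⟩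
  | cons a w ih =>
    obtain ⟨r, Y, h1, h2, rfl⟩ := h
    obtain ⟨σ, h3, h4, h5, rfl⟩ := ih h2
    refine ⟨fun i => Nat.casesOn i p σ, rfl, h4, ?_, ?_⟩
    · intro i hi
      cases i with
      | zero => simpa [h3] using h1
      | succ i => simpa using h5 i (by simpa using hi)
    · ext x
      simp only [Set.mem_insert_iff, Set.mem_image, Set.mem_Iio, List.length_cons]
      constructor
      · rintro (rfl | ⟨i, hi, rfl⟩)
        · exact ⟨0, by omega, rfl⟩
        · exact ⟨i + 1, by omega, rfl⟩
      · rintro ⟨i, hi, rfl⟩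
        cases i with
        | zero => left; rfl
        | succ i => right; exact ⟨i, by omega, rfl⟩

theorem HPath.cycle_run {S A : Type*} [Inhabited A] {Δ : S → A → S → Prop} {w : List A} {p : S}
    {X : Set S} (h : HPath Δ p w p X) (hw : w ≠ []) :
    ∃ ρ : ℕ → S, ρ 0 = p ∧ (∀ i, Δ (ρ i) (hom w i) (ρ (i + 1))) ∧ InfOcc ρ = X := by
  obtain ⟨σ, h1, h2, h3, rfl⟩ := h.to_fun
  have hL : 0 < w.length := List.length_pos_iff.2 hw
  refine ⟨fun i => σ (i % w.length), by simpa using h1, ?_, ?_⟩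
  · intro i
    have hi := Nat.mod_lt i hL
    have := h3 _ hi
    have e : σ ((i + 1) % w.length) = σ (i % w.length + 1) := by
      rw [Nat.add_mod]
      by_cases hc : i % w.length + 1 < w.length
      · rw [Nat.mod_eq_of_lt (a := 1) (by omega), Nat.mod_eq_of_lt hc]
      · have hc' : i % w.length + 1 = w.length := by omega
        rw [hc', h2, ← h1, ← Nat.add_mod]
        congr 1
        rw [← Nat.mod_add_mod, hc', Nat.mod_self]
    simp only [e]
    exact this
  · ext x
    simp only [InfOcc, Set.mem_setOf_eq, Set.mem_image, Set.mem_Iio]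
    constructor
    · intro hx
      obtain ⟨m, _, hm⟩ := hx 0
      exact ⟨_, Nat.mod_lt m hL, hm⟩
    · rintro ⟨i, hi, rfl⟩ N
      refine ⟨N * w.length + i, ?_, ?_⟩
      · nlinarith
      · simp [Nat.mod_eq_of_lt hi]

theorem HPath.prefix_run {S A : Type*} {Δ : S → A → S → Prop} {u : List A} {p q : S} {X : Set S}
    (h : HPath Δ p u q X) (α : ℕ → A) (ρ : ℕ → S) (h0 : ρ 0 = q)
    (h1 : ∀ i, Δ (ρ i) (α i) (ρ (i + 1))) :
    ∃ τ : ℕ → S, τ 0 = p ∧ (∀ i, Δ (τ i) (happ u α i) (τ (i + 1))) ∧ InfOcc τ = InfOcc ρ := by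
  induction u generalizing p X with
  | nil =>
    obtain ⟨rfl, rfl⟩ := h
    exact ⟨ρ, h0, h1, rfl⟩
  | cons a u ih =>
    obtain ⟨r, Y, h2, h3, rfl⟩ := h
    obtain ⟨τ, h4, h5, h6⟩ := ih h3
    refine ⟨fun i => Nat.casesOn i p τ, rfl, ?_, ?_⟩
    · intro i
      cases i with
      | zero => simpa [happ, h4] using h2
      | succ i => exact h5 i
    · rw [← h6]
      ext x
      constructor
      · intro hx N
        obtain ⟨m, hm, e⟩ := hx (N + 1)
        cases m with
        | zero => omega
        | succ m => exact ⟨m, by omega, e⟩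
      · intro hx N
        obtain ⟨m, hm, e⟩ := hx N
        exact ⟨m + 1, by omega, e⟩

theorem lasso_run {S A : Type*} [Inhabited A] {Δ : S → A → S → Prop} {u v : List A} {p q : S}
    {X Y : Set S} (h : HPath Δ p u q X) (h' : HPath Δ q v q Y) (hv : v ≠ []) :
    ∃ τ : ℕ → S, τ 0 = p ∧ (∀ i, Δ (τ i) (happ u (hom v) i) (τ (i + 1))) ∧ InfOcc τ = Y := by
  obtain ⟨ρ, h0, h1, h2⟩ := h'.cycle_run hv
  obtain ⟨τ, a, b, c⟩ := h.prefix_run _ ρ h0 h1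
  exact ⟨τ, a, b, c.trans h2⟩

theorem eventually_infOcc {S : Type*} [Finite S] (ρ : ℕ → S) :
    ∃ N, ∀ m, N ≤ m → ρ m ∈ InfOcc ρ := by
  have := Fintype.ofFinite S
  have h : ∀ s : S, ∃ N, s ∉ InfOcc ρ → ∀ m, N ≤ m → ρ m ≠ s := by
    intro s
    by_cases hs : s ∈ InfOcc ρ
    · exact ⟨0, fun h => absurd hs h⟩
    · have hs' := hs
      simp only [InfOcc, Set.mem_setOf_eq, not_forall, not_exists, not_and] at hs'
      obtain ⟨N, hN⟩ := hs'
      exact ⟨N, fun _ => hN⟩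
  choose N hN using h
  refine ⟨Finset.univ.sup N, fun m hm => ?_⟩
  by_contra hc
  exact hN (ρ m) hc m (le_trans (Finset.le_sup (Finset.mem_univ _)) hm) rfl

theorem run_lasso {S A : Type*} [Finite S] [Inhabited A] {Δ : S → A → S → Prop} {w : List A}
    (hw : w ≠ []) (ρ : ℕ → S) (h : ∀ i, Δ (ρ i) (hom w i) (ρ (i + 1))) :
    ∃ q k₀ k₁ Y, 0 < k₁ ∧ HPath Δ (ρ 0) (listPow w k₀) q Y ∧
      HPath Δ q (listPow w k₁) q (InfOcc ρ) := by
  have := Fintype.ofFinite S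
  have hL : 0 < w.length := List.length_pos_iff.2 hw
  obtain ⟨N, hN⟩ := eventually_infOcc ρ
  obtain ⟨N', hN'⟩ := eventually_infOcc (fun i => ρ (i * w.length))
  have hq := hN' N' le_rfl
  set q := ρ (N' * w.length) with hqd
  obtain ⟨k₀, hk₀, e₀⟩ := hq N
  have hc : ∀ s : S, ∃ m, s ∈ InfOcc ρ → k₀ * w.length ≤ m ∧ ρ m = s := by
    intro s
    by_cases hs : s ∈ InfOcc ρ
    · obtain ⟨m, hm⟩ := hs (k₀ * w.length)
      exact ⟨m, fun _ => hm⟩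
    · exact ⟨0, fun h => absurd h hs⟩
  choose M hM using hc
  obtain ⟨k', hk', e'⟩ := hq (max (k₀ + 1) (Finset.univ.sup M + 1))
  have hk1 : k₀ + 1 ≤ k' := le_trans (le_max_left _ _) hk'
  have hk2 : Finset.univ.sup M + 1 ≤ k' := le_trans (le_max_right _ _) hk'
  simp only at e₀ e'
  refine ⟨q, k₀, k' - k₀, ρ '' Set.Ico 0 (k₀ * w.length), by omega, ?_, ?_⟩
  · have := HPath_of_run _ ρ h (k₀ * w.length) 0
    have hb := hom_blocks w 0 k₀
    rw [Nat.zero_mul] at hb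
    rw [hb, Nat.zero_add, e₀] at this
    exact this
  · have := HPath_of_run _ ρ h ((k' - k₀) * w.length) (k₀ * w.length)
    rw [hom_blocks, ← Nat.add_mul, Nat.add_sub_cancel' (by omega), e₀, e'] at this
    convert this using 1
    ext s
    constructor
    · intro hs
      obtain ⟨h1, h2⟩ := hM s hs
      refine ⟨M s, ⟨h1, ?_⟩, h2⟩
      have : M s ≤ Finset.univ.sup M := Finset.le_sup (Finset.mem_univ _)
      nlinarith
    · rintro ⟨m, ⟨hm, _⟩, rfl⟩
      apply hN
      nlinarith

theorem card_bound {A S T ι : Type*} [Inhabited A] [Fintype T] [Fintype ι] (B : NGBW A S)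
    (C : NSW A T) (hC : C.Lang = B.Langᶜ) (w : ι → List A) (hw : ∀ i, w i ≠ [])
    (hrej : ∀ i, hom (w i) ∉ B.Lang)
    (hconf : ∀ i j, i ≠ j → ∀ k₀ k₁ k₂, 0 < k₁ → 0 < k₂ →
      happ (listPow (w i) k₀) (hom (listPow (w i) k₁ ++ listPow (w j) k₂)) ∈ B.Lang) :
    Fintype.card ι ≤ Fintype.card T := by
  have key : ∀ i, ∃ (q : T) (X : Set T), (∀ t, (X ∩ (C.acc t).2).Nonempty →
      (X ∩ (C.acc t).1).Nonempty) ∧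
      (∃ p ∈ C.I, ∃ k₀ Y, HPath C.Δ p (listPow (w i) k₀) q Y) ∧
      ∃ k₁, 0 < k₁ ∧ HPath C.Δ q (listPow (w i) k₁) q X := by
    intro i
    have : hom (w i) ∈ C.Lang := by rw [hC]; exact hrej i
    obtain ⟨ρ, h0, h1, h2⟩ := this
    obtain ⟨q, k₀, k₁, Y, h3, h4, h5⟩ := run_lasso (hw i) ρ h1
    exact ⟨q, InfOcc ρ, h2, ⟨_, h0, k₀, Y, h4⟩, k₁, h3, h5⟩
  choose q X hX hpre hcyc using key
  apply Fintype.card_le_of_injective q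
  intro i j hij
  by_contra hne
  obtain ⟨p, hp, k₀, Y, h0⟩ := hpre i
  obtain ⟨k₁, hk₁, h1⟩ := hcyc i
  obtain ⟨k₂, hk₂, h2⟩ := hcyc j
  rw [← hij] at h2
  have hnil : listPow (w i) k₁ ++ listPow (w j) k₂ ≠ [] := by
    obtain ⟨k, rfl⟩ : ∃ j, k₁ = j + 1 := ⟨k₁ - 1, by omega⟩
    simp [listPow, List.replicate_succ, hw i]
  obtain ⟨τ, t0, t1, t2⟩ := lasso_run h0 (h1.append h2) hnil
  have hin : happ (listPow (w i) k₀) (hom (listPow (w i) k₁ ++ listPow (w j) k₂)) ∈ C.Lang := by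
    refine ⟨τ, by rw [t0]; exact hp, t1, ?_⟩
    rw [t2]
    intro t
    rw [Set.union_inter_distrib_right, Set.union_inter_distrib_right]
    rintro (⟨x, hx | hx⟩)
    · exact (hX i t ⟨x, hx⟩).mono Set.subset_union_left
    · exact (hX j t ⟨x, hx⟩).mono Set.subset_union_right
  rw [hC] at hin
  exact hin (hconf i j hne k₀ k₁ k₂ hk₁ hk₂)

/-- The specification of segments that is used in the proof. -/
structure HSeg (n k : ℕ) (F : Fin k → Finset (Fin (n - 1)))
    (f : Fin (n - 1) → Fin (n - 1)) (g : Fin (n - 1) → Fin k) (w : List (FBAlpha n)) : Prop where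
  ne : w ≠ []
  sound : ∀ x y X, HPath (FBgen n k F).Δ x w y X → ∃ p r, x = some p ∧ y = some r ∧
    (f r < f p ∨ (r = p ∧ ∀ t ∈ F (g p), some t ∉ X))
  loop : ∀ p, ∃ X, HPath (FBgen n k F).Δ (some p) w (some p) X ∧
    ∀ i, i ≠ g p → ∃ t ∈ F i, some t ∈ X
  dec : ∀ p q, f q < f p → ∃ X, HPath (FBgen n k F).Δ (some p) w (some q) X ∧
    ∀ i, ∃ t ∈ F i, some t ∈ X

theorem HSeg.rej {n k : ℕ} {F : Fin k → Finset (Fin (n - 1))}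
    {f : Fin (n - 1) → Fin (n - 1)} {g : Fin (n - 1) → Fin k} {w : List (FBAlpha n)}
    (h : HSeg n k F f g w) : hom w ∉ (FBgen n k F).Lang := by
  rintro ⟨ρ, _, h1, h2⟩
  have hL : 0 < w.length := List.length_pos_iff.2 h.ne
  have hp := fun i => h.sound _ _ _ (by
    have := HPath_of_run _ ρ h1 w.length (i * w.length)
    rw [hom_block] at this
    exact this)
  choose σ σ' e1 e2 e3 using hp
  have hs : ∀ i, σ' i = σ (i + 1) := by
    intro i
    have a := e2 i
    have b := e1 (i + 1)
    rw [Nat.succ_mul] at b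
    rw [a] at b
    exact Option.some.inj b
  obtain ⟨i, hi⟩ : ∃ i, ∀ j, f (σ i) ≤ f (σ j) := by
    obtain ⟨_, ⟨i, rfl⟩, hi⟩ := WellFounded.has_min (wellFounded_lt (α := Fin (n - 1)))
      (Set.range fun i => f (σ i)) ⟨_, 0, rfl⟩
    exact ⟨i, fun j => not_lt.1 (hi _ ⟨j, rfl⟩)⟩
  have hconst : ∀ j, σ (i + j) = σ i := by
    intro j
    induction j with
    | zero => rfl
    | succ j ih =>
      rcases e3 (i + j) with h | ⟨h, _⟩
      · rw [hs, ih] at h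
        exact absurd h (not_lt.2 (hi _))
      · rw [hs, ih] at h
        exact h
  obtain ⟨x, hx, t, ht, rfl⟩ := h2 (g (σ i))
  obtain ⟨m, hm, e⟩ := hx (i * w.length)
  have hj : i ≤ m / w.length := (Nat.le_div_iff_mul_le hL).2 hm
  obtain ⟨j, hj⟩ := Nat.exists_eq_add_of_le hj
  have hdm := Nat.div_add_mod m w.length
  have hml := Nat.mod_lt m hL
  rcases e3 (i + j) with h | ⟨_, h⟩
  · rw [hs, add_assoc, hconst, hconst] at h
    exact lt_irrefl _ h
  · rw [hconst] at h
    apply h t ht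
    refine ⟨m, ⟨?_, ?_⟩, e⟩
    · rw [← hj, Nat.mul_comm]; omega
    · rw [← hj, Nat.mul_comm]; omega

theorem HSeg.conf {n k : ℕ} {F : Fin k → Finset (Fin (n - 1))}
    {f f' : Equiv.Perm (Fin (n - 1))} {g g' : Fin (n - 1) → Fin k} {w w' : List (FBAlpha n)}
    (h : HSeg n k F f g w) (h' : HSeg n k F f' g' w') (hne : f ≠ f' ∨ g ≠ g')
    (k₀ k₁ k₂ : ℕ) (hk₁ : 0 < k₁) (hk₂ : 0 < k₂) :
    happ (listPow w k₀) (hom (listPow w k₁ ++ listPow w' k₂)) ∈ (FBgen n k F).Lang := by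
  have main : ∃ p q X Y, HPath (FBgen n k F).Δ (some p) w (some q) X ∧
      HPath (FBgen n k F).Δ (some q) w' (some p) Y ∧ ∀ i, ∃ t ∈ F i, some t ∈ X ∪ Y := by
    by_cases hf : f = f'
    · have hg : g ≠ g' := by tauto
      obtain ⟨p, hp⟩ := Function.ne_iff.1 hg
      obtain ⟨X, hX, hX'⟩ := h.loop p
      obtain ⟨Y, hY, hY'⟩ := h'.loop p
      refine ⟨p, p, X, Y, hX, hY, fun i => ?_⟩
      by_cases hi : i = g p
      · obtain ⟨t, ht, ht'⟩ := hY' i (by rw [hi]; exact hp)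
        exact ⟨t, ht, Or.inr ht'⟩
      · obtain ⟨t, ht, ht'⟩ := hX' i hi
        exact ⟨t, ht, Or.inl ht'⟩
    · have : ∃ p q, f q < f p ∧ f' p < f' q := by
        by_contra hc
        push Not at hc
        apply hf
        -- f' ∘ f⁻¹ is monotone
        have hm : StrictMono (f' * f⁻¹ : Equiv.Perm (Fin (n - 1))) := by
          intro a b hab
          have := hc (f⁻¹ b) (f⁻¹ a) (by simpa using hab)
          refine lt_of_le_of_ne (by simpa using this) ?_
          intro e
          exact hab.ne ((f' * f⁻¹).injective e)
        have hid : (f' * f⁻¹ : Equiv.Perm (Fin (n - 1))) = 1 := by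
          ext x
          have := hm.range_inj (g := id) strictMono_id
          have h2 := this.1 (by simp [Equiv.range_eq_univ])
          rw [h2]; rfl
        exact (mul_inv_eq_one.1 hid).symm
      obtain ⟨p, q, h1, h2⟩ := this
      obtain ⟨X, hX, hX'⟩ := h.dec p q h1
      obtain ⟨Y, hY, hY'⟩ := h'.dec q p h2
      refine ⟨p, q, X, Y, hX, hY, fun i => ?_⟩
      obtain ⟨t, ht, ht'⟩ := hX' i
      exact ⟨t, ht, Or.inl ht'⟩
  obtain ⟨p, q, X, Y, hX, hY, hXY⟩ := main
  obtain ⟨L, hL, _⟩ := h.loop p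
  obtain ⟨L', hL', _⟩ := h'.loop q
  obtain ⟨P, hP⟩ := hL.pow_loop k₀
  obtain ⟨Z, hZ, hZ'⟩ := hL.pow_end hX k₁ hk₁
  obtain ⟨Z', hZ2, hZ2'⟩ := hL'.pow_end hY k₂ hk₂
  have hnil : listPow w k₁ ++ listPow w' k₂ ≠ [] := by
    obtain ⟨k, rfl⟩ : ∃ j, k₁ = j + 1 := ⟨k₁ - 1, by omega⟩
    simp [listPow, List.replicate_succ, h.ne]
  obtain ⟨τ, _, t1, t2⟩ := lasso_run hP (hZ.append hZ2) hnil
  refine ⟨τ, trivial, t1, fun i => ?_⟩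
  obtain ⟨t, ht, ht'⟩ := hXY i
  refine ⟨some t, ?_, t, ht, rfl⟩
  rw [t2]
  exact Set.union_subset_union hZ' hZ2' ht'

/-- The first letter of a move. -/
def mvA (n : ℕ) (keep : Prop) (p s : Fin (n - 1)) : FBAlpha n :=
  {e | (∃ z, e = (some z, some z) ∧ z ≠ s ∧ (z ≠ p ∨ keep)) ∨ e = (some p, some s) ∨
    e = (some s, none)}

/-- The second letter of a move. -/
def mvB (n : ℕ) (s q : Fin (n - 1)) : FBAlpha n :=
  {e | (∃ z, e = (some z, some z) ∧ z ≠ s) ∨ e = (some s, some q) ∨ e = (none, some s)}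

/-- The identity letter on main states. -/
def mvI (n : ℕ) : FBAlpha n := {e | ∃ z, e = (some z, some z)}

/-- A move. -/
def mv (n : ℕ) (keep : Prop) (p s q : Fin (n - 1)) : List (FBAlpha n) :=
  [mvA n keep p s, mvB n s q]

theorem HPath_pair {S A : Type*} {Δ : S → A → S → Prop} {a b : A} {p q : S} {X : Set S} :
    HPath Δ p [a, b] q X ↔ ∃ r, Δ p a r ∧ Δ r b q ∧ X = {p, r} := by
  constructor
  · rintro ⟨r, Y, h1, ⟨r', Z, h2, ⟨rfl, rfl⟩, rfl⟩, rfl⟩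
    exact ⟨r, h1, h2, by simp⟩
  · rintro ⟨r, h1, h2, rfl⟩
    exact ⟨r, {r}, h1, ⟨q, ∅, h2, ⟨rfl, rfl⟩, by simp⟩, rfl⟩

theorem mv_sound {n k : ℕ} (F : Fin k → Finset (Fin (n - 1))) {keep : Prop}
    {p s q : Fin (n - 1)} (hps : p ≠ s) {z : Fin (n - 1)} {y : FBState n} {X : Set (FBState n)}
    (h : HPath (FBgen n k F).Δ (some z) (mv n keep p s q) y X) :
    (y = some z ∧ X ⊆ {some z, none}) ∨ (z = p ∧ y = some q ∧ X = {some p, some s}) := by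
  obtain ⟨r, h1, h2, rfl⟩ := HPath_pair.1 h
  change (some z, r) ∈ mvA n keep p s at h1
  change (r, y) ∈ mvB n s q at h2
  rcases h1 with ⟨z', e, h3, h4⟩ | e | e
  · simp only [Prod.mk.injEq, Option.some.injEq] at e
    obtain ⟨rfl, rfl⟩ := e
    rcases h2 with ⟨z', e, h5⟩ | e | e
    · simp only [Prod.mk.injEq, Option.some.injEq] at e
      obtain ⟨rfl, rfl⟩ := e
      left; exact ⟨rfl, by simp⟩
    · simp only [Prod.mk.injEq, Option.some.injEq] at e
      exact absurd e.1 h3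
    · simp at e
  · simp only [Prod.mk.injEq, Option.some.injEq] at e
    obtain ⟨rfl, rfl⟩ := e
    rcases h2 with ⟨z', e, h5⟩ | e | e
    · simp only [Prod.mk.injEq, Option.some.injEq] at e
      exact absurd e.1.symm h5
    · simp only [Prod.mk.injEq, Option.some.injEq] at e
      right; exact ⟨rfl, e.2, rfl⟩
    · simp at e
  · simp only [Prod.mk.injEq, Option.some.injEq] at e
    obtain ⟨rfl, rfl⟩ := e
    rcases h2 with ⟨z', e, h5⟩ | e | e
    · simp at e
    · simp at e
    · simp only [Prod.mk.injEq, true_and] at e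
      left; exact ⟨e, by simp⟩

theorem mv_jump {n k : ℕ} (F : Fin k → Finset (Fin (n - 1))) (keep : Prop)
    (p s q : Fin (n - 1)) :
    HPath (FBgen n k F).Δ (some p) (mv n keep p s q) (some q) {some p, some s} :=
  HPath_pair.2 ⟨some s, Or.inr (Or.inl rfl), Or.inr (Or.inl rfl), rfl⟩

theorem mv_stay {n k : ℕ} (F : Fin k → Finset (Fin (n - 1))) (keep : Prop)
    (p s q z : Fin (n - 1)) (h : z ≠ p ∨ keep) :
    ∃ X, HPath (FBgen n k F).Δ (some z) (mv n keep p s q) (some z) X := by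
  by_cases hz : z = s
  · subst hz
    exact ⟨_, HPath_pair.2 ⟨none, Or.inr (Or.inr rfl), Or.inr (Or.inr rfl), rfl⟩⟩
  · exact ⟨_, HPath_pair.2 ⟨some z, Or.inl ⟨z, rfl, hz, h⟩, Or.inl ⟨z, rfl, hz⟩, rfl⟩⟩

/-- Soundness from main states. -/
def HSound (n k : ℕ) (F : Fin k → Finset (Fin (n - 1)))
    (f : Fin (n - 1) → Fin (n - 1)) (g : Fin (n - 1) → Fin k) (w : List (FBAlpha n)) : Prop :=
  ∀ p y X, HPath (FBgen n k F).Δ (some p) w y X → ∃ r, y = some r ∧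
    (f r < f p ∨ (r = p ∧ ∀ t ∈ F (g p), some t ∉ X))

theorem HSound.append {n k : ℕ} {F : Fin k → Finset (Fin (n - 1))}
    {f : Fin (n - 1) → Fin (n - 1)} {g : Fin (n - 1) → Fin k} {u v : List (FBAlpha n)}
    (hu : HSound n k F f g u) (hv : HSound n k F f g v) : HSound n k F f g (u ++ v) := by
  intro p y X h
  obtain ⟨r, Y, Z, h1, h2, rfl⟩ := (HPath_append _ _ _ _ _).1 h
  obtain ⟨r, rfl, h3⟩ := hu _ _ _ h1
  obtain ⟨r', rfl, h4⟩ := hv _ _ _ h2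
  refine ⟨r', rfl, ?_⟩
  rcases h3 with h3 | ⟨rfl, h3⟩
  · rcases h4 with h4 | ⟨rfl, h4⟩
    · exact Or.inl (h4.trans h3)
    · exact Or.inl h3
  · rcases h4 with h4 | ⟨rfl, h4⟩
    · exact Or.inl h4
    · refine Or.inr ⟨rfl, fun t ht => ?_⟩
      rintro (h | h)
      · exact h3 t ht h
      · exact h4 t ht h

theorem HSound.flatMap {n k : ℕ} {F : Fin k → Finset (Fin (n - 1))}
    {f : Fin (n - 1) → Fin (n - 1)} {g : Fin (n - 1) → Fin k} {β : Type*} (l : List β)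
    (W : β → List (FBAlpha n)) (h : ∀ b, HSound n k F f g (W b)) :
    HSound n k F f g (l.flatMap W) := by
  induction l with
  | nil =>
    rintro p y X ⟨rfl, rfl⟩
    exact ⟨p, rfl, Or.inr ⟨rfl, by simp⟩⟩
  | cons b l ih =>
    rw [List.flatMap_cons]
    exact (h b).append ih

theorem flatMap_loop {S A β : Type*} {Δ : S → A → S → Prop} (l : List β) (W : β → List A) (p : S)
    (G : β → Set S → Prop) (hG : ∀ b X Y, G b X → X ⊆ Y → G b Y)
    (h : ∀ b, ∃ X, HPath Δ p (W b) p X ∧ G b X) :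
    ∃ X, HPath Δ p (l.flatMap W) p X ∧ ∀ b ∈ l, G b X := by
  induction l with
  | nil => exact ⟨∅, ⟨rfl, rfl⟩, by simp⟩
  | cons b l ih =>
    obtain ⟨X, h1, h2⟩ := ih
    obtain ⟨Y, h3, h4⟩ := h b
    refine ⟨Y ∪ X, ?_, ?_⟩
    · rw [List.flatMap_cons]
      exact h3.append h1
    · intro c hc
      rcases List.mem_cons.1 hc with rfl | hc
      · exact hG _ _ _ h4 Set.subset_union_left
      · exact hG _ _ _ (h2 c hc) Set.subset_union_right

theorem exists_HSeg {n k : ℕ} {F : Fin k → Finset (Fin (n - 1))}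
    (f : Fin (n - 1) → Fin (n - 1)) (g : Fin (n - 1) → Fin k)
    (hg : ∀ q, q ∉ F (g q)) (hne : ∀ i, (F i).Nonempty)
    (hanti : ∀ i j, i ≠ j → ∃ s ∈ F i, s ∉ F j) :
    ∃ w, HSeg n k F f g w := by
  classical
  choose e he using hne
  have hs' : ∀ p j, ∃ s, j ≠ g p → s ∈ F j ∧ s ∉ F (g p) := by
    intro p j
    by_cases hj : j = g p
    · exact ⟨p, fun h => absurd hj h⟩
    · obtain ⟨s, hs⟩ := hanti _ _ hj
      exact ⟨s, fun _ => hs⟩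
  choose s hs using hs'
  let V1 : Fin (n - 1) × Fin k → List (FBAlpha n) := fun b =>
    if b.2 ≠ g b.1 ∧ b.1 ∉ F b.2 then mv n False b.1 (s b.1 b.2) b.1 else []
  let V2 : Fin (n - 1) × Fin (n - 1) → List (FBAlpha n) := fun b =>
    if f b.2 < f b.1 then mv n True b.1 (e (g b.1)) b.2 else []
  have hnil : HSound n k F f g [] := by
    rintro p y X ⟨rfl, rfl⟩
    exact ⟨p, rfl, Or.inr ⟨rfl, by simp⟩⟩
  have hstay : ∀ (z : Fin (n - 1)) (X : Set (FBState n)), X ⊆ {some z, none} →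
      ∀ t ∈ F (g z), some t ∉ X := by
    intro z X hX t ht h
    have := hX h
    simp only [Set.mem_insert_iff, Option.some.injEq, Set.mem_singleton_iff, reduceCtorEq,
      or_false] at this
    subst this
    exact hg _ ht
  have hV1 : ∀ b, HSound n k F f g (V1 b) := by
    rintro ⟨p, j⟩
    simp only [V1]
    split_ifs with hc
    · intro z y X h
      obtain ⟨h1, h2⟩ := hs p j hc.1
      have hps : p ≠ s p j := by rintro e; rw [← e] at h1; exact hc.2 h1
      rcases mv_sound F hps h with ⟨rfl, h3⟩ | ⟨rfl, rfl, rfl⟩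
      · exact ⟨z, rfl, Or.inr ⟨rfl, hstay _ _ h3⟩⟩
      · refine ⟨z, rfl, Or.inr ⟨rfl, ?_⟩⟩
        intro t ht h
        simp only [Set.mem_insert_iff, Option.some.injEq, Set.mem_singleton_iff] at h
        rcases h with rfl | rfl
        · exact hg _ ht
        · exact h2 ht
    · exact hnil
  have hV2 : ∀ b, HSound n k F f g (V2 b) := by
    rintro ⟨p, q⟩
    simp only [V2]
    split_ifs with hc
    · intro z y X h
      have hps : p ≠ e (g p) := by
        intro h
        have := he (g p)
        rw [← h] at this
        exact hg p this
      rcases mv_sound F hps h with ⟨rfl, h3⟩ | ⟨rfl, rfl, rfl⟩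
      · exact ⟨z, rfl, Or.inr ⟨rfl, hstay _ _ h3⟩⟩
      · exact ⟨q, rfl, Or.inl hc⟩
    · exact hnil
  have hI : ∀ p, HPath (FBgen n k F).Δ (some p) [mvI n] (some p) {some p} := fun p =>
    ⟨some p, ∅, ⟨p, rfl⟩, ⟨rfl, rfl⟩, by simp⟩
  have hIS : HSound n k F f g [mvI n] := by
    rintro p y X ⟨r, Y, ⟨z, h1⟩, ⟨rfl, rfl⟩, rfl⟩
    simp only [Prod.mk.injEq, Option.some.injEq] at h1
    obtain ⟨rfl, rfl⟩ := h1
    exact ⟨p, rfl, Or.inr ⟨rfl, hstay _ _ (by simp)⟩⟩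
  let l1 := (Finset.univ : Finset (Fin (n - 1) × Fin k)).toList
  let l2 := (Finset.univ : Finset (Fin (n - 1) × Fin (n - 1))).toList
  have hloop1 : ∀ p, ∃ X, HPath (FBgen n k F).Δ (some p) ([mvI n] ++ l1.flatMap V1) (some p) X ∧
      ∀ i, i ≠ g p → ∃ t ∈ F i, some t ∈ X := by
    intro p
    obtain ⟨X, h1, h2⟩ := flatMap_loop (Δ := (FBgen n k F).Δ) l1 V1 (some p)
      (fun b X => b.1 = p → b.2 ≠ g p → p ∉ F b.2 → some (s p b.2) ∈ X)
      (fun b X Y h hXY a1 a2 a3 => hXY (h a1 a2 a3)) (by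
        rintro ⟨p', j⟩
        simp only [V1]
        split_ifs with hc
        · by_cases hpp : p' = p
          · subst hpp
            exact ⟨_, mv_jump F _ _ _ _, by simp⟩
          · obtain ⟨X, hX⟩ := mv_stay F False p' (s p' j) p' p (Or.inl (Ne.symm hpp))
            exact ⟨X, hX, fun h => absurd h hpp⟩
        · refine ⟨∅, ⟨rfl, rfl⟩, ?_⟩
          rintro rfl h1 h2
          exact absurd ⟨h1, h2⟩ hc)
    refine ⟨_, (hI p).append h1, fun i hi => ?_⟩
    by_cases hp : p ∈ F i
    · exact ⟨p, hp, Or.inl rfl⟩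
    · exact ⟨s p i, (hs p i hi).1, Or.inr (h2 (p, i) (by simp [l1]) rfl hi hp)⟩
  have hstay2 : ∀ p b, ∃ X, HPath (FBgen n k F).Δ (some p) (V2 b) (some p) X ∧ True := by
    rintro p ⟨p', q⟩
    simp only [V2]
    split_ifs with hc
    · obtain ⟨X, hX⟩ := mv_stay F True p' (e (g p')) q p (Or.inr trivial)
      exact ⟨X, hX, trivial⟩
    · exact ⟨∅, ⟨rfl, rfl⟩, trivial⟩
  have hloop2 : ∀ (l : List (Fin (n - 1) × Fin (n - 1))) p, ∃ X,
      HPath (FBgen n k F).Δ (some p) (l.flatMap V2) (some p) X := by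
    intro l p
    obtain ⟨X, hX, _⟩ := flatMap_loop (Δ := (FBgen n k F).Δ) l V2 (some p)
      (fun _ _ => True) (by simp) (hstay2 p)
    exact ⟨X, hX⟩
  refine ⟨([mvI n] ++ l1.flatMap V1) ++ l2.flatMap V2, by simp, ?_, ?_, ?_⟩
  · intro x y X h
    cases x with
    | none =>
      obtain ⟨r, Y, h1, _⟩ := h
      obtain ⟨z, hz⟩ := h1
      simp at hz
    | some p =>
      obtain ⟨r, h1, h2⟩ :=
        ((hIS.append (HSound.flatMap l1 V1 hV1)).append (HSound.flatMap l2 V2 hV2)) p y X h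
      exact ⟨p, r, rfl, h1, h2⟩
  · intro p
    obtain ⟨X, h1, h2⟩ := hloop1 p
    obtain ⟨Y, h3⟩ := hloop2 l2 p
    refine ⟨_, h1.append h3, fun i hi => ?_⟩
    obtain ⟨t, ht, ht'⟩ := h2 i hi
    exact ⟨t, ht, Or.inl ht'⟩
  · intro p q hpq
    obtain ⟨X, h1, h2⟩ := hloop1 p
    obtain ⟨a, b, hab⟩ := List.append_of_mem (show (p, q) ∈ l2 by simp [l2])
    obtain ⟨Y, h3⟩ := hloop2 a p
    obtain ⟨Z, h4⟩ := hloop2 b q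
    have h5 : HPath (FBgen n k F).Δ (some p) (V2 (p, q)) (some q) {some p, some (e (g p))} := by
      simp only [V2, if_pos hpq]
      exact mv_jump F _ _ _ _
    have h6 := h1.append (h3.append (h5.append h4))
    rw [hab, List.flatMap_append, List.flatMap_cons]
    refine ⟨_, h6, fun i => ?_⟩
    by_cases hi : i = g p
    · exact ⟨e (g p), by rw [hi]; exact he _, by simp⟩
    · obtain ⟨t, ht, ht'⟩ := h2 i hi
      exact ⟨t, ht, Or.inl ht'⟩

theorem streett_part
    (n k : ℕ) (hn : 1 < n) (hk1 : 1 < k) (hk2 : k ≤ (n - 1).choose ((n - 1) / 2))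
    (F : Fin k → Finset (Fin (n - 1))) (hF : GoodAcc n k F)
    (T : Type) [Fintype T] (C : NSW (FBAlpha n) T) (hC : C.Lang = (FBgen n k F).Langᶜ) :
    (n - 1).factorial * (k / 2) ^ (n - 1) ≤ Fintype.card T := by
  classical
  obtain ⟨hinj, hcard, hav⟩ := hF
  have hn3 : 3 ≤ n := by
    by_contra h
    have : n = 2 := by omega
    subst this
    simp at hk2
    omega
  have hne : ∀ i, (F i).Nonempty := by
    intro i
    rw [← Finset.card_pos, hcard]
    omega
  have hanti : ∀ i j, i ≠ j → ∃ s ∈ F i, s ∉ F j := by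
    intro i j hij
    by_contra hc
    push Not at hc
    exact hij (hinj (Finset.eq_of_subset_of_card_le hc (by rw [hcard, hcard])))
  let ι := Equiv.Perm (Fin (n - 1)) × ((q : Fin (n - 1)) → {i : Fin k // q ∉ F i})
  have hw : ∀ x : ι, ∃ w, HSeg n k F x.1 (fun q => (x.2 q).1) w := fun x =>
    exists_HSeg _ _ (fun q => (x.2 q).2) hne hanti
  choose w hw using hw
  have hb := card_bound (FBgen n k F) C hC w (fun i => (hw i).ne) (fun i => (hw i).rej) (by
    intro i j hij k₀ k₁ k₂ hk₁ hk₂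
    refine (hw i).conf (hw j) ?_ k₀ k₁ k₂ hk₁ hk₂
    by_contra hc
    push Not at hc
    apply hij
    refine Prod.ext hc.1 ?_
    funext q
    exact Subtype.ext (congrFun hc.2 q))
  refine le_trans ?_ hb
  rw [Fintype.card_prod, Fintype.card_perm, Fintype.card_fin, Fintype.card_pi]
  apply Nat.mul_le_mul_left
  calc (k / 2) ^ (n - 1) = ∏ _q : Fin (n - 1), (k / 2) := by simp
    _ ≤ _ := by
      apply Finset.prod_le_prod'
      intro q _
      refine (hav q).trans (le_of_eq ?_)
      rw [← Nat.card_eq_fintype_card]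
      rfl

end Helpers

/-- (a) every nondeterministic Streett automaton accepting the complement of
`L(FB (n,k))`, and (b) every deterministic complete Rabin automaton accepting `L(FB (n,k))`,
has at least `(n-1)! ⌊k/2⌋^{n-1}` states. -/
theorem streett_complementation_and_rabin_determinization_lower_bound
    (n k : ℕ) (hn : 1 < n) (hk1 : 1 < k) (hk2 : k ≤ (n - 1).choose ((n - 1) / 2))
    (F : Fin k → Finset (Fin (n - 1))) (hF : GoodAcc n k F) :
    (∀ (T : Type) [Fintype T] (C : NSW (FBAlpha n) T),
      C.Lang = (FBgen n k F).Langᶜ →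
        (n - 1).factorial * (k / 2) ^ (n - 1) ≤ Fintype.card T) ∧
    (∀ (T : Type) [Fintype T] (R : NRW (FBAlpha n) T),
      (∃ q₀ : T, R.I = {q₀}) → (∀ p a, ∃! q, R.Δ p a q) →
        R.Lang = (FBgen n k F).Lang →
          (n - 1).factorial * (k / 2) ^ (n - 1) ≤ Fintype.card T) := by
  refine ⟨fun T _ C hC => streett_part n k hn hk1 hk2 F hF T C hC, ?_⟩
  rintro T _ R ⟨q₀, hq₀⟩ hdet hR
  refine streett_part n k hn hk1 hk2 F hF T
    ⟨R.I, R.Δ, R.k, fun i => ((R.acc i).2, (R.acc i).1)⟩ ?_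
  rw [← hR]
  choose δ hδ hδu using hdet
  ext α
  constructor
  · rintro ⟨ρ, h0, h1, h2⟩ ⟨τ, t0, t1, i, t2, t3⟩
    have e : ρ = τ := by
      funext m
      induction m with
      | zero =>
        simp only [hq₀, Set.mem_singleton_iff] at h0 t0
        rw [h0, t0]
      | succ m ih =>
        rw [hδu _ _ _ (h1 m), hδu _ _ _ (t1 m), ih]
    subst e
    have := h2 i t2
    simp only at this
    rw [t3] at this
    simp at this
  · intro h
    let ρ : ℕ → T := fun m => Nat.rec q₀ (fun j x => δ x (α j)) m
    refine ⟨ρ, by simp [hq₀, ρ], fun i => hδ _ _, ?_⟩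
    intro i hi
    by_contra hc
    exact h ⟨ρ, by simp [hq₀, ρ], fun i => hδ _ _, i, hi, Set.not_nonempty_iff_eq_empty.1 hc⟩


end YanPaper
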